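/- Let α₁,…,α_k ∈ [0,1] be pairwise ζ-separated, i.e., |α_i − α_j| ≥ ζ for all i ≠ j, and let V_α be the k×k Vandermonde matrix with entries (V_α)_{ij} = α_j^i for 0 ≤ i ≤ k−1, 1 ≤ j ≤ k. Then V_α is invertible and its inverse satisfies ‖V_α^{-1}‖_∞ ≤ 2^k / ζ^{k−1}, where ‖M‖_∞ denotes the operator norm induced by the ℓ_∞ vector norm (the maximum absolute row sum of M). -/

import Mathlib

open Matrix

lemma aux_step (Q : Polynomial ℝ) (c a M : ℝ) (hc : |c| ≤ M) (ha : |a| ≤ 1) (N : ℕ) :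
    ∑ j ∈ Finset.range N, |(Polynomial.C c * (Polynomial.X - Polynomial.C a) * Q).coeff j|
      ≤ (2 * M) * ∑ j ∈ Finset.range N, |Q.coeff j| := by
  have hM : 0 ≤ M := (abs_nonneg c).trans hc
  have h1 : ∀ j, |(Polynomial.C c * (Polynomial.X - Polynomial.C a) * Q).coeff j|
      ≤ M * (|(Polynomial.X * Q).coeff j| + |Q.coeff j|) := by
    intro j
    rw [mul_assoc, Polynomial.coeff_C_mul, sub_mul, Polynomial.coeff_sub,
      Polynomial.coeff_C_mul, abs_mul]
    refine mul_le_mul hc ((abs_sub _ _).trans ?_) (abs_nonneg _) hM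
    rw [abs_mul]
    have := mul_le_mul_of_nonneg_right ha (abs_nonneg (Q.coeff j))
    linarith
  have h2 : ∑ j ∈ Finset.range N, |(Polynomial.X * Q).coeff j|
      ≤ ∑ j ∈ Finset.range N, |Q.coeff j| := by
    cases N with
    | zero => simp
    | succ n =>
      rw [Finset.sum_range_succ', Finset.sum_range_succ]
      simp [Polynomial.coeff_X_mul]
  refine (Finset.sum_le_sum fun j _ => h1 j).trans ?_
  rw [← Finset.mul_sum, Finset.sum_add_distrib]
  nlinarith

lemma aux_prod {ι : Type*} [DecidableEq ι] (s : Finset ι) (c a : ι → ℝ) (M : ℝ) (hM : 0 ≤ M)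
    (hc : ∀ i ∈ s, |c i| ≤ M) (ha : ∀ i ∈ s, |a i| ≤ 1) (N : ℕ) :
    ∑ j ∈ Finset.range N,
      |(∏ i ∈ s, (Polynomial.C (c i) * (Polynomial.X - Polynomial.C (a i)))).coeff j|
      ≤ (2 * M) ^ s.card := by
  induction s using Finset.induction_on with
  | empty =>
    cases N with
    | zero => simp
    | succ n => rw [Finset.sum_range_succ']; simp [Polynomial.coeff_one]
  | insert x s hx ih =>
    rw [Finset.prod_insert hx, Finset.card_insert_of_notMem hx, pow_succ']
    refine (aux_step _ _ _ M (hc x (by simp)) (ha x (by simp)) N).trans ?_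
    exact mul_le_mul_of_nonneg_left
      (ih (fun i hi => hc i (by simp [hi])) (fun i hi => ha i (by simp [hi]))) (by positivity)

/-- For `ζ`-separated points `α₁, …, α_k ∈ [0,1]`, the `k × k`
Vandermonde matrix `V_α` (with `(V_α)_{ij} = α_j^i`) is invertible and the
ℓ∞ → ℓ∞ operator norm of its inverse (the maximum absolute row sum) satisfies
`‖V_α⁻¹‖_∞ ≤ 2^k / ζ^(k-1)`. -/
theorem vandermonde_inverse_norm_bound
    (k : ℕ) (hk : 0 < k)
    (α : Fin k → ℝ) (hα : ∀ i, α i ∈ Set.Icc (0 : ℝ) 1)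
    (ζ : ℝ) (hζ : 0 < ζ)
    (hsep : ∀ i j, i ≠ j → ζ ≤ |α i - α j|)
    (V : Matrix (Fin k) (Fin k) ℝ)
    (hV : ∀ i j, V i j = α j ^ (i : ℕ)) :
    IsUnit V.det ∧ ∀ i, ∑ j, |V⁻¹ i j| ≤ 2 ^ k / ζ ^ (k - 1) := by
  have hinj : Function.Injective α := by
    intro i j h
    by_contra hne
    have := hsep i j hne
    rw [h, sub_self, abs_zero] at this
    linarith
  have hinj' : Set.InjOn α (Finset.univ : Finset (Fin k)) := hinj.injOn
  let W : Matrix (Fin k) (Fin k) ℝ :=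
    Matrix.of fun i j => (Lagrange.basis Finset.univ α i).coeff (j : ℕ)
  have hWV : W * V = 1 := by
    ext i l
    rw [Matrix.mul_apply]
    have hdeg : (Lagrange.basis Finset.univ α i).natDegree < k := by
      have := Lagrange.degree_basis hinj' (Finset.mem_univ i)
      rw [Polynomial.natDegree_eq_of_degree_eq_some this]
      simp; omega
    have := Polynomial.eval_eq_sum_range' hdeg (α l)
    rw [Finset.sum_range] at this
    simp only [W, Matrix.of_apply, hV]
    rw [← this, Matrix.one_apply]
    split_ifs with h
    · subst h; exact Lagrange.eval_basis_self hinj' (Finset.mem_univ i)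
    · exact Lagrange.eval_basis_of_ne h (Finset.mem_univ l)
  refine ⟨Matrix.isUnit_det_of_left_inverse hWV, fun i => ?_⟩
  rw [Matrix.inv_eq_left_inv hWV]
  have := aux_prod (Finset.univ.erase i) (fun j => (α i - α j)⁻¹) α ζ⁻¹ (by positivity)
    (fun j hj => by
      rw [abs_inv]
      exact inv_anti₀ hζ (hsep i j (Finset.ne_of_mem_erase hj).symm))
    (fun j _ => by rw [abs_of_nonneg (hα j).1]; exact (hα j).2) k
  rw [Finset.sum_range, Finset.card_erase_of_mem (Finset.mem_univ i), Finset.card_univ,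
    Fintype.card_fin] at this
  refine le_trans this ?_
  rw [mul_pow, inv_pow, ← div_eq_mul_inv]
  gcongr
  · norm_num
  · omega
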